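/- There exist universal constants c, C > 0 such that the following holds. Let G = (V, E) be a finite undirected multigraph on n ≥ 2 vertices, let T > 0, let β > 0 and 0 < α < c / log n, and let D be an integral orientation of G such that for every edge directed by D from u toward v, the truncated in-degrees satisfy min(d⁻_D(v), T) ≤ (1 + α)·min(d⁻_D(u), T) + β. Then μ = max_{v ∈ V} min(d⁻_D(v), T) satisfies μ ≤ e^{C·√(α·log n)} · ( ρ(G) + C·√(log n / α)·β ). -/

import Mathlib

open Finset

/-- A fractional orientation of a finite undirected multigraph whose edges are
indexed by `E`, where edge `e` joins the two distinct vertices `a e` and `b e`.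
`y e v` is the (nonnegative) fraction of edge `e` oriented toward `v`, and for
each edge the two fractions at its endpoints sum to `1`. -/
structure FracOrient (V E : Type*) (a b : E → V) where
  y : E → V → ℝ
  nonneg : ∀ e v, 0 ≤ y e v
  sum_one : ∀ e, y e (a e) + y e (b e) = 1

/-- The fractional in-degree `ȳ(v)`: the sum, over edges incident to `v`,
of the fraction of the edge oriented toward `v`. -/
noncomputable def inDeg {V E : Type*} [Fintype E] [DecidableEq V]
    (a b : E → V) (y : E → V → ℝ) (v : V) : ℝ :=
  ∑ e ∈ univ.filter (fun e => a e = v ∨ b e = v), y e v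

/-- The maximum fractional in-degree `max_{v ∈ V} ȳ(v)`. -/
noncomputable def maxInDeg {V E : Type*} [Fintype E] [DecidableEq V]
    (a b : E → V) (y : E → V → ℝ) : ℝ :=
  sSup (Set.range (inDeg a b y))

/-- The density `|E(S)|/|S|` of a set `S` of vertices: the number of edges with
both endpoints in `S` (counted with multiplicity), divided by `|S|`. -/
noncomputable def density {V E : Type*} [Fintype E] [DecidableEq V]
    (a b : E → V) (S : Finset V) : ℝ :=
  ((univ.filter fun e => a e ∈ S ∧ b e ∈ S).card : ℝ) / S.card

/-- The maximum subgraph density `ρ(G) = max_{∅ ≠ S ⊆ V} |E(S)|/|S|`. -/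
noncomputable def maxDensity {V E : Type*} [Fintype E] [DecidableEq V]
    (a b : E → V) : ℝ :=
  sSup { d : ℝ | ∃ S : Finset V, S.Nonempty ∧ d = density a b S }

/-- A fractional orientation is locally optimal if it never directs any
fraction of an edge toward an endpoint of strictly larger in-degree. -/
def LocallyOpt {V E : Type*} [Fintype E] [DecidableEq V]
    (a b : E → V) (y : E → V → ℝ) : Prop :=
  ∀ e, (0 < y e (b e) → inDeg a b y (b e) ≤ inDeg a b y (a e)) ∧
       (0 < y e (a e) → inDeg a b y (a e) ≤ inDeg a b y (b e))

/-- `(α, β)`-local optimality: if `y(e,v) > 0` then `ȳ(v) < (1+α)·ȳ(u) + β`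
for the other endpoint `u` of `e`. -/
def ApxLocallyOpt {V E : Type*} [Fintype E] [DecidableEq V]
    (a b : E → V) (y : E → V → ℝ) (α β : ℝ) : Prop :=
  ∀ e, (0 < y e (b e) → inDeg a b y (b e) < (1 + α) * inDeg a b y (a e) + β) ∧
       (0 < y e (a e) → inDeg a b y (a e) < (1 + α) * inDeg a b y (b e) + β)

/-- The in-degree of `v` under an integral orientation given by a head map
`h : E → V` (edge `e` is directed toward `h e`). -/
noncomputable def intInDeg {V E : Type*} [Fintype E] [DecidableEq V]
    (h : E → V) (v : V) : ℝ :=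
  ((univ.filter fun e => h e = v).card : ℝ)

lemma density_le_maxDensity {V E : Type*} [Fintype V] [Fintype E] [DecidableEq V]
    (a b : E → V) (S : Finset V) (hS : S.Nonempty) : density a b S ≤ maxDensity a b := by
  unfold maxDensity
  refine le_csSup ?_ ⟨S, hS, rfl⟩
  have hf : (Set.range (fun S : Finset V => density a b S)).Finite := Set.finite_range _
  refine hf.bddAbove.mono ?_
  rintro d ⟨S, -, rfl⟩
  exact ⟨S, rfl⟩

/-- Thresholds of the level sets. -/
noncomputable def thr (α β t : ℝ) : ℕ → ℝ
  | 0 => t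
  | i + 1 => (thr α β t i - β) / (1 + α)

lemma thr_bound (α β t : ℝ) (hα : 0 < α) (hβ : 0 < β) (i : ℕ) :
    t ≤ (1 + α) ^ i * (thr α β t i + i * β) := by
  induction i with
  | zero => simp [thr]
  | succ i ih =>
    have h1 : thr α β t i = (1 + α) * thr α β t (i + 1) + β := by
      simp only [thr]; field_simp; ring
    refine ih.trans ?_
    rw [h1, pow_succ, mul_assoc]
    refine mul_le_mul_of_nonneg_left ?_ (by positivity)
    push_cast
    have : 0 ≤ α * ((i + 1 : ℝ) * β) := by positivity
    nlinarith

lemma level_step {V E : Type*} [Fintype V] [Fintype E] [DecidableEq V]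
    (a b : E → V) (h : E → V) (hh : ∀ e, h e = a e ∨ h e = b e)
    (d : V → ℝ) (hd0 : ∀ v, 0 ≤ d v) (hd : ∀ v, d v ≤ intInDeg h v)
    (α β : ℝ) (hα : 0 < α) (hβ : 0 < β)
    (hloc : ∀ e, (h e = a e → d (a e) ≤ (1 + α) * d (b e) + β) ∧
      (h e = b e → d (b e) ≤ (1 + α) * d (a e) + β)) (t : ℝ)
    (hne : (univ.filter fun v => t ≤ d v).Nonempty) :
    t * ((univ.filter fun v => t ≤ d v).card : ℝ) ≤
      maxDensity a b * ((univ.filter fun v => (t - β) / (1 + α) ≤ d v).card : ℝ) := by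
  have hpos : 0 < 1 + α := by linarith
  set S := univ.filter fun v => t ≤ d v with hS
  set S' := univ.filter fun v => (t - β) / (1 + α) ≤ d v with hS'
  have hsub : S ⊆ S' := by
    intro v hv
    simp only [hS, hS', mem_filter, mem_univ, true_and] at hv ⊢
    rw [div_le_iff₀ hpos]
    nlinarith [hd0 v, mul_nonneg hα.le (hd0 v)]
  have hS'ne : S'.Nonempty := hne.mono hsub
  have hc : (0 : ℝ) < S'.card := by exact_mod_cast hS'ne.card_pos
  have h1 := density_le_maxDensity a b S' hS'ne
  unfold density at h1
  rw [div_le_iff₀ hc] at h1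
  refine le_trans ?_ h1
  have h2 : (univ.filter fun e => h e ∈ S) ⊆ univ.filter fun e => a e ∈ S' ∧ b e ∈ S' := by
    intro e he
    simp only [mem_filter, mem_univ, true_and] at he ⊢
    have he' := hsub he
    have ht : t ≤ d (h e) := by simpa [hS] using he
    have key : ∀ u, d (h e) ≤ (1 + α) * d u + β → u ∈ S' := by
      intro u hu
      simp only [hS', mem_filter, mem_univ, true_and]
      rw [div_le_iff₀ hpos]
      linarith
    rcases hh e with h3 | h3
    · have := (hloc e).1 h3
      rw [← h3] at this
      exact ⟨h3 ▸ he', key _ this⟩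
    · have := (hloc e).2 h3
      rw [← h3] at this
      exact ⟨key _ this, h3 ▸ he'⟩
  have h3 : (univ.filter fun e => h e ∈ S).card =
      ∑ v ∈ S, (univ.filter fun e => h e = v).card := by
    rw [Finset.card_eq_sum_card_fiberwise (f := h) (t := S)]
    · refine Finset.sum_congr rfl fun v hv => ?_
      congr 1
      ext e
      simp only [mem_filter, mem_univ, true_and]
      constructor
      · exact fun h => h.2
      · rintro rfl; exact ⟨hv, rfl⟩
    · intro e he
      simpa using he
  have h4 : t * (S.card : ℝ) ≤ ((univ.filter fun e => h e ∈ S).card : ℝ) := by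
    rw [h3]
    push_cast
    rw [mul_comm, ← nsmul_eq_mul]
    refine Finset.card_nsmul_le_sum _ _ _ fun v hv => ?_
    have : t ≤ d v := by simpa [hS] using hv
    exact this.trans (hd v)
  exact h4.trans (by exact_mod_cast Finset.card_le_card h2)

/-- There exist universal constants `c, C > 0` such that for
every finite multigraph on `n ≥ 2` vertices, every threshold `T > 0`, every
`β > 0` and `0 < α < c / log n`, and every integral orientation satisfying the
truncated local optimality condition
`min(d⁻(v), T) ≤ (1+α)·min(d⁻(u), T) + β` for every edge directed from `u`
toward `v`, the maximum truncated in-degree `μ = max_v min(d⁻(v), T)` satisfies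
`μ ≤ e^{C·√(α·log n)} · (ρ(G) + C·√(log n / α)·β)`. -/
theorem truncated_apxLocal_implies_global : ∃ c C : ℝ, 0 < c ∧ 0 < C ∧
    ∀ (V E : Type) [Fintype V] [Fintype E] [DecidableEq V],
    ∀ a b : E → V, (∀ e, a e ≠ b e) → 2 ≤ Fintype.card V →
    ∀ T : ℝ, 0 < T →
    ∀ β : ℝ, 0 < β →
    ∀ α : ℝ, 0 < α → α < c / Real.log (Fintype.card V) →
    ∀ h : E → V, (∀ e, h e = a e ∨ h e = b e) →
    (∀ e, (h e = a e →
        min (intInDeg h (a e)) T ≤ (1 + α) * min (intInDeg h (b e)) T + β) ∧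
      (h e = b e →
        min (intInDeg h (b e)) T ≤ (1 + α) * min (intInDeg h (a e)) T + β)) →
    sSup (Set.range fun v => min (intInDeg h v) T) ≤
      Real.exp (C * Real.sqrt (α * Real.log (Fintype.card V))) *
        (maxDensity a b +
          C * Real.sqrt (Real.log (Fintype.card V) / α) * β) := by
  refine ⟨1, 4, one_pos, by norm_num, ?_⟩
  intro V E _ _ _ a b hab hn T hT β hβ α hα hαc h hh hloc
  have hne : Nonempty V := Fintype.card_pos_iff.mp (by omega)
  set n := Fintype.card V with hnn
  set L := Real.log n with hL
  have hn2 : (2 : ℝ) ≤ n := by exact_mod_cast hn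
  have hL2 : (1 / 2 : ℝ) ≤ L := by
    have h1 : Real.log 2 ≤ L := Real.log_le_log (by norm_num) hn2
    have := Real.log_two_gt_d9
    linarith
  have hLpos : 0 < L := by linarith
  set x := Real.sqrt (α * L) with hx
  set s := Real.sqrt (L / α) with hs
  have hx0 : 0 ≤ x := Real.sqrt_nonneg _
  have hsL : L ≤ s := by
    apply Real.le_sqrt_of_sq_le
    rw [le_div_iff₀ hα]
    rw [lt_div_iff₀ hLpos] at hαc
    nlinarith
  have hxs : x * s = L := by
    rw [hx, hs, ← Real.sqrt_mul (by positivity)]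
    rw [show α * L * (L / α) = L ^ 2 by field_simp]
    exact Real.sqrt_sq hLpos.le
  have hαs : α * s = x := by
    have h1 : s ^ 2 = L / α := Real.sq_sqrt (by positivity)
    have h2 : α * s * s = x * s := by
      rw [hxs, mul_assoc, ← sq, h1]; field_simp
    exact mul_right_cancel₀ (by linarith) h2
  set k := ⌈s⌉₊ with hk
  have hk1 : s ≤ k := Nat.le_ceil _
  have hk2 : (k : ℝ) ≤ 3 * s := by
    have := Nat.ceil_lt_add_one (show 0 ≤ s by linarith)
    linarith
  refine ciSup_le fun v0 => ?_
  set d : V → ℝ := fun v => min (intInDeg h v) T with hd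
  set t := thr α β (d v0) with ht
  have hd0 : ∀ v, 0 ≤ d v := fun v => le_min (by unfold intInDeg; positivity) hT.le
  set N : ℕ → ℝ := fun i => ((univ.filter fun v => t i ≤ d v).card : ℝ) with hN
  have hρ : 0 ≤ maxDensity a b := by
    refine le_trans ?_ (density_le_maxDensity a b univ univ_nonempty)
    unfold density; positivity
  set q := Real.exp x with hq
  have hq0 : 0 < q := Real.exp_pos _
  have hsucc : ∀ i, t (i + 1) = (t i - β) / (1 + α) := fun i => rfl
  have hmem : ∀ i, v0 ∈ univ.filter fun v => t i ≤ d v := by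
    intro i
    simp only [mem_filter, mem_univ, true_and]
    induction i with
    | zero => exact le_refl _
    | succ i ih =>
      rw [hsucc, div_le_iff₀ (by linarith)]
      nlinarith [hd0 v0, mul_nonneg hα.le (hd0 v0)]
  have hN1 : ∀ i, 0 < N i := fun i => by
    have := Finset.card_pos.mpr ⟨v0, hmem i⟩
    simp only [hN]
    exact_mod_cast this
  have hstep : ∀ i, t i * N i ≤ maxDensity a b * N (i + 1) := fun i =>
    level_step a b h hh d hd0 (fun v => min_le_left _ _) α β hα hβ hloc (t i) ⟨v0, hmem i⟩
  have hex : ∃ i ≤ k, N (i + 1) ≤ q * N i := by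
    by_contra hcon
    push Not at hcon
    have hind : ∀ i ≤ k + 1, q ^ i ≤ N i := by
      intro i
      induction i with
      | zero =>
        intro _
        have := Finset.card_pos.mpr ⟨v0, hmem 0⟩
        simp only [hN, pow_zero]
        exact_mod_cast this
      | succ i ih =>
        intro hi
        have h1 := ih (by omega)
        have h2 := hcon i (by omega)
        rw [pow_succ]
        nlinarith
    have h1 := hind k (by omega)
    have h2 := hcon k le_rfl
    have h3 : (n : ℝ) ≤ q ^ k := by
      rw [hq, ← Real.exp_nat_mul]
      calc (n : ℝ) = Real.exp L := (Real.exp_log (by linarith)).symm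
        _ ≤ _ := Real.exp_le_exp.mpr (by nlinarith)
    have h4 : N (k + 1) ≤ n := by
      simp only [hN]
      exact_mod_cast Finset.card_le_univ _
    have hq1 : 1 ≤ q := Real.one_le_exp hx0
    nlinarith
  obtain ⟨i, hik, hi⟩ := hex
  have hti : t i ≤ maxDensity a b * q := by
    have h1 := hstep i
    have h2 := mul_le_mul_of_nonneg_left hi hρ
    exact le_of_mul_le_mul_right (by linarith) (hN1 i)
  have hik' : (i : ℝ) ≤ k := by exact_mod_cast hik
  have hb := thr_bound α β (d v0) hα hβ i
  have hpow : (1 + α) ^ i ≤ Real.exp (3 * x) := by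
    calc (1 + α) ^ i ≤ (Real.exp α) ^ i := by
          gcongr
          linarith [Real.add_one_le_exp α]
      _ = Real.exp (i * α) := by rw [← Real.exp_nat_mul]
      _ ≤ _ := Real.exp_le_exp.mpr (by nlinarith)
  have hs0 : 0 ≤ s := by linarith
  have hq1 : 1 ≤ q := Real.one_le_exp hx0
  calc d v0 ≤ (1 + α) ^ i * (t i + i * β) := hb
    _ ≤ (1 + α) ^ i * (q * (maxDensity a b + 4 * s * β)) := by
        refine mul_le_mul_of_nonneg_left ?_ (by positivity)
        have h1 : (i : ℝ) * β ≤ 4 * s * β := by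
          refine mul_le_mul_of_nonneg_right ?_ hβ.le
          linarith
        have h2 : 0 ≤ 4 * s * β := by positivity
        nlinarith
    _ ≤ Real.exp (3 * x) * (q * (maxDensity a b + 4 * s * β)) := by
        refine mul_le_mul_of_nonneg_right hpow (by positivity)
    _ = Real.exp (4 * x) * (maxDensity a b + 4 * s * β) := by
        rw [← mul_assoc, hq, ← Real.exp_add]
        congr 2
        ring
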